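/- Let k, l, n be integers with k ≥ 2, 0 ≤ l ≤ k−2 and n ≥ 1. The number of (k,l)-extended Motzkin paths of length n, i.e., of sequences (y_0, …, y_n) of integers with y_0 = 0, y_i ≥ 0 for all i, y_i − y_{i−1} ≥ −(k−1) for all 1 ≤ i ≤ n, and 0 ≤ y_n ≤ l, equals the Raney number R_n^{(k,l+1)} = ((l+1)/(kn+l+1))·binom(kn+l+1, n). -/

import Mathlib

/-- Paths of length `n` whose down steps have size at most `k - 1`, ending at height at most `h`. -/
def motzkinPaths (k n : ℕ) (h : ℤ) : Set (Fin (n + 1) → ℤ) :=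
  {y | y 0 = 0 ∧ (∀ i, 0 ≤ y i) ∧
    (∀ i : Fin n, y i.succ - y i.castSucc ≥ -((k : ℤ) - 1)) ∧ y (Fin.last n) ≤ h}

/-- The Raney number `R_n^{(k,r)}`, as a rational number. -/
def raney (k n r : ℕ) : ℚ := (r : ℚ) / (k * n + r) * Nat.choose (k * n + r) n

theorem raney_succ_succ (k n r : ℕ) (hk : 1 ≤ k) :
    raney k (n + 1) (r + 1) = raney k (n + 1) r + raney k n (r + k) := by
  obtain ⟨M, hM⟩ : ∃ M, M = k * n + r + k := ⟨_, rfl⟩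
  have hM' : (M : ℚ) = k * n + r + k := by exact_mod_cast hM
  have hnM : n ≤ M := by nlinarith
  have hM0 : (M : ℚ) ≠ 0 := by
    have : M ≠ 0 := by omega
    exact_mod_cast this
  have hM1 : (M : ℚ) + 1 ≠ 0 := by positivity
  have hN : (n : ℚ) + 1 ≠ 0 := by positivity
  have e₁ : ((M + 1).choose (n + 1) : ℚ) = (M + 1) * M.choose n / (n + 1) := by
    rw [eq_div_iff hN]
    exact_mod_cast (Nat.add_one_mul_choose_eq M n).symm
  have e₂ : (M.choose (n + 1) : ℚ) = M.choose n * (M - n) / (n + 1) := by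
    rw [eq_div_iff hN, ← Nat.cast_sub hnM]
    exact_mod_cast Nat.choose_succ_right_eq M n
  have c₁ : k * (n + 1) + (r + 1) = M + 1 := by rw [hM]; ring
  have c₂ : k * (n + 1) + r = M := by rw [hM]; ring
  have c₃ : k * n + (r + k) = M := by rw [hM]; ring
  have d₁ : (k : ℚ) * ((n + 1 : ℕ) : ℚ) + ((r + 1 : ℕ) : ℚ) = M + 1 := by exact_mod_cast c₁
  have d₂ : (k : ℚ) * ((n + 1 : ℕ) : ℚ) + (r : ℚ) = M := by exact_mod_cast c₂
  have d₃ : (k : ℚ) * (n : ℚ) + ((r + k : ℕ) : ℚ) = M := by exact_mod_cast c₃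
  unfold raney
  rw [c₁, c₂, c₃, d₁, d₂, d₃, e₁, e₂]
  push_cast
  field_simp
  rw [hM']
  ring

theorem motzkinPaths_zero (k l : ℕ) : motzkinPaths k 0 l = {0} := by
  ext y
  simp only [motzkinPaths, Set.mem_ofPred_eq, Set.mem_singleton_iff]
  constructor
  · rintro ⟨h, -⟩
    funext i
    rw [Fin.fin_one_eq_zero i, h, Pi.zero_apply]
  · rintro rfl
    simp

theorem motzkinPaths_neg_one (k n : ℕ) : motzkinPaths k n (-1) = ∅ := by
  ext y
  simp only [motzkinPaths, Set.mem_ofPred_eq, Set.mem_empty_iff_false, iff_false]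
  rintro ⟨-, h, -, h'⟩
  have := h (Fin.last n)
  omega

theorem motzkinPaths_succ (k n : ℕ) (h : ℤ) (hh : 0 ≤ h) :
    motzkinPaths k (n + 1) h = motzkinPaths k (n + 1) (h - 1) ∪
      (fun y => Fin.snoc (α := fun _ => ℤ) y h) '' motzkinPaths k n (h + k - 1) := by
  ext y
  simp only [motzkinPaths, Set.mem_union, Set.mem_image, Set.mem_ofPred_eq]
  constructor
  · rintro ⟨h0, hp, hs, hl⟩
    by_cases hy : y (Fin.last (n + 1)) ≤ h - 1
    · exact Or.inl ⟨h0, hp, hs, hy⟩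
    have hy : y (Fin.last (n + 1)) = h := by omega
    refine Or.inr ⟨Fin.init y, ⟨h0, fun i => hp _, fun i => hs i.castSucc, ?_⟩, ?_⟩
    · have := hs (Fin.last n)
      rw [Fin.succ_last, hy] at this
      change y (Fin.last n).castSucc ≤ _
      omega
    · rw [← hy, Fin.snoc_init_self]
  · rintro (⟨h0, hp, hs, hl⟩ | ⟨z, ⟨h0, hp, hs, hl⟩, rfl⟩)
    · exact ⟨h0, hp, hs, by omega⟩
    refine ⟨?_, ?_, ?_, by simp⟩
    · rw [← Fin.castSucc_zero, Fin.snoc_castSucc, h0]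
    · intro i
      refine Fin.lastCases ?_ (fun i => ?_) i
      · simpa using hh
      · simpa using hp i
    · intro i
      refine Fin.lastCases ?_ (fun i => ?_) i
      · rw [Fin.succ_last, Fin.snoc_last, Fin.snoc_castSucc]
        omega
      · rw [Fin.succ_castSucc, Fin.snoc_castSucc, Fin.snoc_castSucc]
        exact hs i

theorem ncard_motzkinPaths_succ (k n : ℕ) (h : ℤ) (hh : 0 ≤ h)
    (hf₁ : (motzkinPaths k (n + 1) (h - 1)).Finite)
    (hf₂ : (motzkinPaths k n (h + k - 1)).Finite) :
    (motzkinPaths k (n + 1) h).ncard =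
      (motzkinPaths k (n + 1) (h - 1)).ncard + (motzkinPaths k n (h + k - 1)).ncard := by
  rw [motzkinPaths_succ k n h hh, Set.ncard_union_eq ?_ hf₁ (hf₂.image _),
    Set.ncard_image_of_injective]
  · intro y z hyz
    exact (Fin.snoc_injective2 hyz).1
  · rw [Set.disjoint_left]
    rintro _ ⟨-, -, -, hl⟩ ⟨z, -, rfl⟩
    simp only [Fin.snoc_last] at hl
    omega

theorem finite_motzkinPaths_and_ncard (k n r : ℕ) (hk : 1 ≤ k) (hnr : 0 < n ∨ 0 < r) :
    (motzkinPaths k n ((r : ℤ) - 1)).Finite ∧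
      ((motzkinPaths k n ((r : ℤ) - 1)).ncard : ℚ) = raney k n r := by
  induction n generalizing r with
  | zero =>
    obtain ⟨l, rfl⟩ : ∃ l, r = l + 1 := ⟨r - 1, by omega⟩
    have hl : (l : ℚ) + 1 ≠ 0 := by positivity
    simp [motzkinPaths_zero, raney, hl]
  | succ n ihn =>
    induction r with
    | zero => simp [motzkinPaths_neg_one, raney]
    | succ r ihr =>
      obtain ⟨hf₁, hc₁⟩ := ihr (by omega)
      obtain ⟨hf₂, hc₂⟩ := ihn (r + k) (by omega)
      have hr : ((r + 1 : ℕ) : ℤ) - 1 = r := by push_cast; ring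
      rw [Nat.cast_add] at hf₂ hc₂
      rw [hr]
      constructor
      · rw [motzkinPaths_succ k n r (by positivity)]
        exact hf₁.union (hf₂.image _)
      · rw [ncard_motzkinPaths_succ k n r (by positivity) hf₁ hf₂, raney_succ_succ k n r hk,
          Nat.cast_add, hc₁, hc₂]


/-- the number of (k,l)-extended Motzkin paths of length n equals
the Raney number R_n^{(k,l+1)} = ((l+1)/(kn+l+1))·binom(kn+l+1, n). -/
theorem count_extended_motzkin_paths (k l n : ℕ) (hk : 2 ≤ k) (hl : l ≤ k - 2)
    (hn : 1 ≤ n) :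
    (Set.ncard {y : Fin (n + 1) → ℤ | y 0 = 0 ∧ (∀ i, 0 ≤ y i) ∧
        (∀ i : Fin n, y i.succ - y i.castSucc ≥ -((k : ℤ) - 1)) ∧
        y (Fin.last n) ≤ l} : ℚ) =
      ((l + 1 : ℚ) / (k * n + l + 1)) * Nat.choose (k * n + l + 1) n := by
  have h := (finite_motzkinPaths_and_ncard k n (l + 1) (by omega) (Or.inl hn)).2
  simpa [motzkinPaths, raney, add_assoc] using h
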